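/- arXiv:1912.11388 — 3 statements merged into one kernel-verified Lean document; each statement's English description precedes it below -/
import Mathlib

section
/- Let n ≥ 2 be an integer, let u = u_1u_2⋯u_s ∈ B* be a word with φ_n(u) equal to the identity permutation, and write γ_n(u) = a_1a_2⋯a_s. Then for every 1 ≤ j ≤ s, there exists a permutation π of A_n such that γ_n(u_j⋯u_su_1⋯u_{j−1}) = π(a_j)⋯π(a_s)π(a_1)⋯π(a_{j−1}); that is, γ_n applied to any conjugate of u equals the corresponding conjugate of γ_n(u) up to a letterwise permutation of the alphabet. -/
/-- The equivalence between `Fin (n-1)` and the elements of `Fin n` of value `< n - 1`. -/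
def finTruncEquiv (n : ℕ) : Fin (n - 1) ≃ {x : Fin n // (x : ℕ) < n - 1} where
  toFun a := ⟨⟨a.1, lt_of_lt_of_le a.2 (Nat.sub_le n 1)⟩, a.2⟩
  invFun x := ⟨x.1.1, x.2⟩
  left_inv a := rfl
  right_inv x := rfl

/-- The permutation of `A_n = {1,…,n}` (modelled as `Fin n`, with letter `i` being
`⟨i-1⟩`) associated to a letter of `B = {0,1}`: letter `0` maps to the `(n-1)`-cycle
`(1 2 ⋯ n-1)` and letter `1` maps to the `n`-cycle `(1 2 ⋯ n)`. -/
def stepPerm (n : ℕ) (b : Fin 2) : Equiv.Perm (Fin n) :=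
  if b = 0 then (finRotate (n - 1)).extendDomain (finTruncEquiv n)
  else finRotate n

/-- `phiRight n u` is the permutation `x ↦ x · φ_n(u)`, the right action of
`φ_n(u) = φ_n(b_1)φ_n(b_2)⋯φ_n(b_k)` on `A_n` (so the letters of `u` act in order,
leftmost first).  In particular `φ_n(u)` is the identity iff `phiRight n u = 1`. -/
def phiRight (n : ℕ) (u : List (Fin 2)) : Equiv.Perm (Fin n) :=
  (u.reverse.map (stepPerm n)).prod

/-- Pansiot's encoding `γ_n : B* → A_n*`: the `i`-th letter `a_i` of `γ_n(u)` is the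
unique letter with `a_i · φ_n(b_1⋯b_i) = 1` (letter `1` is `⟨0, _⟩ : Fin n`). -/
def gammaWord (n : ℕ) (hn : 0 < n) (u : List (Fin 2)) : List (Fin n) :=
  (List.range u.length).map (fun i => (phiRight n (u.take (i + 1)))⁻¹ ⟨0, hn⟩)

theorem phiRight_append (n : ℕ) (p q : List (Fin 2)) :
    phiRight n (p ++ q) = phiRight n q * phiRight n p := by
  simp [phiRight]

theorem length_gammaWord (n : ℕ) (hn : 0 < n) (u : List (Fin 2)) :
    (gammaWord n hn u).length = u.length := by
  simp [gammaWord]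

theorem gammaWord_append (n : ℕ) (hn : 0 < n) (p q : List (Fin 2)) :
    gammaWord n hn (p ++ q) =
      gammaWord n hn p ++ (gammaWord n hn q).map ⇑(phiRight n p)⁻¹ := by
  unfold gammaWord
  rw [List.length_append, List.range_add, List.map_append, List.map_map, List.map_map]
  congr 1
  · refine List.map_congr_left fun i hi => ?_
    rw [List.mem_range] at hi
    rw [List.take_append_of_le_length (by omega)]
  · refine List.map_congr_left fun i _ => ?_
    simp only [Function.comp_apply]
    rw [add_assoc, List.take_length_add_append, phiRight_append, mul_inv_rev, Equiv.Perm.mul_apply]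

/-- If `φ_n(u)` is the identity, then `γ_n` applied to any conjugate
`u_j ⋯ u_s u_1 ⋯ u_{j-1}` of `u` equals the corresponding conjugate
`a_j ⋯ a_s a_1 ⋯ a_{j-1}` of `γ_n(u)` up to a letterwise permutation of the alphabet. -/
theorem gamma_of_conjugate (n : ℕ) (hn : 2 ≤ n) (u : List (Fin 2))
    (hker : phiRight n u = 1) (j : ℕ) (hj1 : 1 ≤ j) (hj2 : j ≤ u.length) :
    ∃ π : Equiv.Perm (Fin n),
      gammaWord n (by omega) (u.rotate (j - 1)) =
        ((gammaWord n (by omega) u).rotate (j - 1)).map π := by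
  have hn0 : 0 < n := by omega
  obtain ⟨p, q, rfl, hp⟩ : ∃ p q, u = p ++ q ∧ p.length = j - 1 :=
    ⟨u.take (j - 1), u.drop (j - 1), (List.take_append_drop _ _).symm, by
      rw [List.length_take]; omega⟩
  rw [phiRight_append] at hker
  refine ⟨phiRight n p, ?_⟩
  rw [← hp, List.rotate_append_length_eq, gammaWord_append, gammaWord_append,
    ← length_gammaWord n hn0 p, List.rotate_append_length_eq, List.map_append, List.map_map,
    ← eq_inv_of_mul_eq_one_right hker]
  simp
end

section
/- Let u be a factor of the infinite word β with period q, and let k ≥ 0 be an integer. If |u| ≥ q + 3^k, then 3^k divides q. -/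
/-- The infinite word `β = (b_i)_{i ≥ 1}` over `{1,2}`: `b_i = 1` if `i ≡ 1 (mod 3)`,
`b_i = 2` if `i ≡ 2 (mod 3)`, and `b_i = b_{i/3}` if `i ≡ 0 (mod 3)`.  (The value at
the unused index `0` is set to `1`.) -/
def betaWord (i : ℕ) : ℕ :=
  if i % 3 = 1 then 1
  else if i % 3 = 2 then 2
  else if h : i = 0 then 1
  else betaWord (i / 3)
decreasing_by exact Nat.div_lt_self (Nat.pos_of_ne_zero h) (by norm_num)

/-- `u` is a factor of `β`: `u = b_i b_{i+1} ⋯ b_{i+|u|-1}` for some index `i ≥ 1`. -/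
def IsBetaFactor (u : List ℕ) : Prop :=
  ∃ i : ℕ, 1 ≤ i ∧ u = (List.range u.length).map (fun j => betaWord (i + j))

/-- `p` is a period of the word `w`: `p` is positive and `w[i] = w[i+p]`
whenever both indices are within `w`. -/
def HasPeriod {α : Type*} (w : List α) (p : ℕ) : Prop :=
  0 < p ∧ ∀ i : ℕ, i + p < w.length → w[i]? = w[i + p]?

theorem betaWord_of_mod_eq_one {n : ℕ} (h : n % 3 = 1) : betaWord n = 1 := by
  rw [betaWord, if_pos h]

theorem betaWord_of_mod_eq_two {n : ℕ} (h : n % 3 = 2) : betaWord n = 2 := by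
  rw [betaWord, if_neg (by omega), if_pos h]

theorem betaWord_three_mul (n : ℕ) : betaWord (3 * n) = betaWord n := by
  rcases Nat.eq_zero_or_pos n with rfl | hn
  · rfl
  · rw [betaWord, if_neg (by omega), if_neg (by omega), dif_neg (by omega),
      Nat.mul_div_cancel_left n (by norm_num)]

/-- If three consecutive letters of `β` agree with their shifts by `q`, then `3 ∣ q`. -/
theorem three_dvd_of_betaWord_shift {i q : ℕ}
    (h : ∀ n, i ≤ n → n < i + 3 → betaWord n = betaWord (n + q)) : 3 ∣ q := by
  by_contra hq
  obtain hq | hq : q % 3 = 1 ∨ q % 3 = 2 := by omega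
  · obtain ⟨n, hin, hni, hn⟩ : ∃ n, i ≤ n ∧ n < i + 3 ∧ n % 3 = 1 :=
      ⟨i + (4 - i % 3) % 3, by omega, by omega, by omega⟩
    have := h n hin hni
    rw [betaWord_of_mod_eq_one hn, betaWord_of_mod_eq_two (by omega)] at this
    omega
  · obtain ⟨n, hin, hni, hn⟩ : ∃ n, i ≤ n ∧ n < i + 3 ∧ n % 3 = 2 :=
      ⟨i + (5 - i % 3) % 3, by omega, by omega, by omega⟩
    have := h n hin hni
    rw [betaWord_of_mod_eq_two hn, betaWord_of_mod_eq_one (by omega)] at this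
    omega

/-- If `3 ^ k` consecutive letters of `β` agree with their shifts by `q`, then `3 ^ k ∣ q`. -/
theorem three_pow_dvd_of_betaWord_shift (k : ℕ) {i q : ℕ}
    (h : ∀ n, i ≤ n → n < i + 3 ^ k → betaWord n = betaWord (n + q)) : 3 ^ k ∣ q := by
  induction k generalizing i q with
  | zero => simp
  | succ k ih =>
    have hpow : 3 ^ (k + 1) = 3 * 3 ^ k := pow_succ' 3 k
    have hpos : 0 < 3 ^ k := by positivity
    obtain ⟨r, rfl⟩ : 3 ∣ q :=
      three_dvd_of_betaWord_shift fun n hin hni => h n hin (by omega)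
    rw [hpow]
    refine mul_dvd_mul_left 3 (ih (i := (i + 2) / 3) fun m him hmi => ?_)
    have := h (3 * m) (by omega) (by omega)
    rwa [← mul_add, betaWord_three_mul, betaWord_three_mul] at this

/-- Carpi: if `u` is a factor of `β` with period `q` and `|u| ≥ q + 3^k`, then
`3^k` divides `q`. -/
theorem beta_period_divisibility (u : List ℕ) (q k : ℕ)
    (hu : IsBetaFactor u) (hq : HasPeriod u q) (hlen : q + 3 ^ k ≤ u.length) :
    3 ^ k ∣ q := by
  obtain ⟨i, -, hu⟩ := hu
  have hget : ∀ j < u.length, u[j]? = some (betaWord (i + j)) := fun j hj => by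
    rw [hu]
    simp [hj]
  refine three_pow_dvd_of_betaWord_shift k (i := i) fun n hin hni => ?_
  obtain ⟨j, rfl⟩ := Nat.exists_eq_add_of_le hin
  have := hq.2 j (by omega)
  rw [hget j (by omega), hget (j + q) (by omega)] at this
  simpa [add_assoc] using this
end

section
/- Let m ≥ 4 and t ≥ 1 be integers and let x ∈ Λ_t. Then for every letter a ∈ {4, 5, …, m}, the number |x|_a of occurrences of a in x is a multiple of 4. -/
/-- `max {a ∈ A_m : 4^(a-3) divides i}` (here letters are the natural numbers
`1, …, m`). -/
def lambdaLetter (m i : ℕ) : ℕ :=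
  ((Finset.Icc 1 m).filter (fun a => 4 ^ (a - 3) ∣ i)).sup id

/-- Membership in the set `Λ_t` of words `x = x_0 x_1 ⋯ x_{Mt-1}` over `A_m`
(with `M = 4^(m-2)`) such that `x_i = max {a ∈ A_m : 4^(a-3) ∣ i}` whenever
`i ≡ 0 (mod 4)`, and `x_i ∈ {1,2,3}` whenever `i ≢ 0 (mod 4)`. -/
def InLambda (m t : ℕ) (x : List ℕ) : Prop :=
  x.length = 4 ^ (m - 2) * t ∧
  ∀ i : ℕ, ∀ h : i < x.length,
    (i % 4 = 0 → x[i] = lambdaLetter m i) ∧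
    (i % 4 ≠ 0 → x[i] = 1 ∨ x[i] = 2 ∨ x[i] = 3)

theorem le_lambdaLetter_iff {m b : ℕ} (hb : 1 ≤ b) (hbm : b ≤ m) (i : ℕ) :
    b ≤ lambdaLetter m i ↔ 4 ^ (b - 3) ∣ i := by
  rw [lambdaLetter, Finset.le_sup_iff (by exact hb)]
  simp only [Finset.mem_filter, Finset.mem_Icc, id]
  constructor
  · rintro ⟨c, ⟨-, hc⟩, hbc⟩
    exact (pow_dvd_pow 4 (Nat.sub_le_sub_right hbc 3)).trans hc
  · exact fun h => ⟨b, ⟨⟨hb, hbm⟩, h⟩, le_rfl⟩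

theorem lambdaLetter_le (m i : ℕ) : lambdaLetter m i ≤ m :=
  Finset.sup_le fun _ ha => (Finset.mem_Icc.mp (Finset.mem_filter.mp ha).1).2

namespace InLambda

variable {m t : ℕ} {x : List ℕ}

theorem le_getElem_iff (hx : InLambda m t x) {b : ℕ} (hb : 4 ≤ b) (hbm : b ≤ m)
    {i : ℕ} (hi : i < x.length) : b ≤ x[i] ↔ 4 ^ (b - 3) ∣ i := by
  obtain ⟨h0, h1⟩ := hx.2 i hi
  by_cases h : i % 4 = 0
  · rw [h0 h, le_lambdaLetter_iff (by omega) hbm]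
  · refine iff_of_false (by have := h1 h; omega) fun hd => h ?_
    exact Nat.mod_eq_zero_of_dvd ((dvd_pow_self 4 (by omega)).trans hd)

theorem getElem_le (hx : InLambda m t x) (hm : 3 ≤ m) {i : ℕ} (hi : i < x.length) :
    x[i] ≤ m := by
  obtain ⟨h0, h1⟩ := hx.2 i hi
  by_cases h : i % 4 = 0
  · exact h0 h ▸ lambdaLetter_le m i
  · have := h1 h
    omega

theorem countP_le_eq (hx : InLambda m t x) {b : ℕ} (hb : 4 ≤ b) (hbm : b ≤ m) :
    x.countP (b ≤ ·) = 4 ^ (m + 1 - b) * t := by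
  have hlist : x = (List.range x.length).map fun i => x.getD i 0 := by
    refine List.ext_getElem (by simp) fun i hi _ => ?_
    simp [hi]
  have hlen : x.length = 4 ^ (b - 3) * (4 ^ (m + 1 - b) * t) := by
    rw [hx.1, ← mul_assoc, ← pow_add]
    congr 2
    omega
  have hcount : x.countP (b ≤ ·) = x.length.count (· ≡ 0 [MOD 4 ^ (b - 3)]) := by
    conv_lhs => rw [hlist]
    rw [List.countP_map, Nat.count]
    refine List.countP_congr fun i hi => ?_
    have hi' : i < x.length := List.mem_range.mp hi
    simp [hi', hx.le_getElem_iff hb hbm hi', Nat.modEq_zero_iff_dvd]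
  rw [hcount, Nat.count_modEq_card _ (by positivity), hlen]
  simp

theorem four_dvd_countP_le (hx : InLambda m t x) (hm : 3 ≤ m) {b : ℕ} (hb : 4 ≤ b) :
    4 ∣ x.countP (b ≤ ·) := by
  by_cases hbm : b ≤ m
  · rw [hx.countP_le_eq hb hbm]
    exact (dvd_pow_self 4 (by omega)).mul_right t
  · have hzero : x.countP (b ≤ ·) = 0 := by
      refine List.countP_eq_zero.mpr fun y hy => ?_
      obtain ⟨i, hi, rfl⟩ := List.getElem_of_mem hy
      have := hx.getElem_le hm hi
      simp only [decide_eq_true_eq]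
      omega
    exact hzero ▸ dvd_zero 4

end InLambda

theorem List.count_add_countP_succ_le (x : List ℕ) (a : ℕ) :
    x.count a + x.countP (a + 1 ≤ ·) = x.countP (a ≤ ·) := by
  induction x with
  | nil => simp
  | cons y l ih =>
    simp only [List.count_cons, List.countP_cons, beq_iff_eq, decide_eq_true_eq]
    split_ifs <;> omega

/-- Let `m ≥ 4`, `t ≥ 1` and `x ∈ Λ_t`.  Then for every letter
`a ∈ {4, 5, …, m}`, the number `|x|_a` of occurrences of `a` in `x` is a multiple
of `4`. -/
theorem lambda_letter_count_multiple_of_four (m t : ℕ) (hm : 4 ≤ m) (ht : 1 ≤ t)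
    (x : List ℕ) (hx : InLambda m t x) :
    ∀ a : ℕ, 4 ≤ a → a ≤ m → 4 ∣ x.count a := by
  intro a ha _
  rw [← Nat.dvd_add_left (hx.four_dvd_countP_le (by omega) (b := a + 1) (by omega)),
    x.count_add_countP_succ_le a]
  exact hx.four_dvd_countP_le (by omega) ha
end
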